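/- Let H be a complex Hilbert space, let A and B be positive selfadjoint (possibly unbounded) operators on H with possibly unbounded inverses, and let T ∈ B(H) satisfy T(D(A²)) ⊆ D(B²) together with ‖B²Tv‖ ≤ C‖A²v‖ for all v ∈ D(A²). Then T(D(A)) ⊆ D(B) and ‖BTv‖ ≤ √(‖T‖·C)·‖Av‖ for all v ∈ D(A). -/

import Mathlib

/-!
STATEMENT 12 (Proposition 2.1, interpolation): if `A, B` are positive selfadjoint
operators on a Hilbert space `H`, `T ∈ B(H)` maps `D(A²)` into `D(B²)` with
`‖B²Tv‖ ≤ C‖A²v‖`, then `T` maps `D(A)` into `D(B)` with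
`‖BTv‖ ≤ √(‖T‖C)·‖Av‖`.
-/

open scoped InnerProductSpace ComplexInnerProductSpace

/-- A log-convex nonnegative sequence of growth rate at most `p` satisfies `b 1 ≤ p * b 0`. -/
theorem le_mul_of_sq_le_mul_of_le_geom {b : ℕ → ℝ} {K p : ℝ} (hp : 0 ≤ p)
    (hb : ∀ n, 0 ≤ b n) (hconv : ∀ n, b (n + 1) ^ 2 ≤ b (n + 2) * b n)
    (hgrow : ∀ n, b n ≤ K * p ^ n) : b 1 ≤ p * b 0 := by
  by_contra! hlt
  have hb1 : 0 < b 1 := lt_of_le_of_lt (mul_nonneg hp (hb 0)) hlt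
  have hb0 : 0 < b 0 := by
    refine lt_of_le_of_ne (hb 0) fun h => ?_
    have := hconv 0
    simp only [← h, mul_zero, zero_add] at this
    nlinarith
  have hratio : ∀ n, 0 < b n ∧ b 1 * b n ≤ b (n + 1) * b 0 := by
    intro n
    induction n with
    | zero => exact ⟨hb0, le_rfl⟩
    | succ n ih =>
      obtain ⟨hn, hle⟩ := ih
      have hn1 : 0 < b (n + 1) := by
        have := mul_pos hb1 hn
        exact pos_of_mul_pos_left (this.trans_le hle) hb0.le
      refine ⟨hn1, le_of_mul_le_mul_right ?_ hn⟩
      calc b 1 * b (n + 1) * b n = b 1 * b n * b (n + 1) := by ring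
        _ ≤ b (n + 1) * b 0 * b (n + 1) := by gcongr
        _ = b (n + 1) ^ 2 * b 0 := by ring
        _ ≤ b (n + 2) * b n * b 0 := by gcongr; exact hconv n
        _ = b (n + 1 + 1) * b 0 * b n := by ring
  set q := b 1 / b 0 with hq
  have hpq : p < q := by rwa [hq, lt_div_iff₀ hb0]
  have hqn : ∀ n, q ^ n * b 0 ≤ b n := by
    intro n
    induction n with
    | zero => simp
    | succ n ih =>
      have h1 : q * b n ≤ b (n + 1) := by
        rw [hq, div_mul_eq_mul_div, div_le_iff₀ hb0]
        exact (hratio n).2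
      calc q ^ (n + 1) * b 0 = q * (q ^ n * b 0) := by ring
        _ ≤ q * b n := by gcongr
        _ ≤ b (n + 1) := h1
  have hq0 : 0 < q := hp.trans_lt hpq
  have hlim : Filter.Tendsto (fun n : ℕ => K * (p / q) ^ n) Filter.atTop (nhds 0) := by
    simpa using (tendsto_pow_atTop_nhds_zero_of_lt_one (div_nonneg hp hq0.le)
      ((div_lt_one hq0).2 hpq)).const_mul K
  refine absurd (ge_of_tendsto' hlim fun n => ?_) (not_le.2 hb0)
  rw [div_pow, mul_div_assoc', le_div_iff₀ (pow_pos hq0 n), mul_comm]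
  exact (hqn n).trans (hgrow n)

section

variable {H : Type*} [NormedAddCommGroup H] [InnerProductSpace ℂ H]

/-- Reid's inequality for a nonlinear map `P` which is symmetric with respect to the
semi-inner product `⟪R u, R w⟫`. -/
theorem norm_apply_le_of_symmetrizable (R : H →L[ℂ] H) (P : H → H) {p : ℝ} (hp : 0 ≤ p)
    (hP : ∀ u, ‖P u‖ ≤ p * ‖u‖) (hsymm : ∀ u w, ⟪R (P u), R w⟫_ℂ = ⟪R u, R (P w)⟫_ℂ) (u : H) :
    ‖R (P u)‖ ≤ p * ‖R u‖ := by
  have hiter : ∀ n, ‖P^[n] u‖ ≤ p ^ n * ‖u‖ := by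
    intro n
    induction n with
    | zero => simp
    | succ n ih =>
      rw [Function.iterate_succ_apply', pow_succ', mul_assoc]
      exact (hP _).trans (by gcongr)
  refine le_mul_of_sq_le_mul_of_le_geom (b := fun n => ‖R (P^[n] u)‖) (K := ‖R‖ * ‖u‖) hp
    (fun n => norm_nonneg _) (fun n => ?_) (fun n => ?_)
  · simp only [Function.iterate_succ_apply']
    calc ‖R (P (P^[n] u))‖ ^ 2 = ‖⟪R (P (P^[n] u)), R (P (P^[n] u))⟫_ℂ‖ := by
          rw [inner_self_eq_norm_sq_to_K]; simp
      _ = ‖⟪R (P (P (P^[n] u))), R (P^[n] u)⟫_ℂ‖ := by rw [hsymm (P (P^[n] u))]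
      _ ≤ _ := norm_inner_le_norm _ _
  · calc ‖R (P^[n] u)‖ ≤ ‖R‖ * ‖P^[n] u‖ := R.le_opNorm _
      _ ≤ ‖R‖ * (p ^ n * ‖u‖) := by gcongr; exact hiter n
      _ = ‖R‖ * ‖u‖ * p ^ n := by ring

namespace LinearPMap

theorem norm_sq_add_le_norm_add_smul_sq {A : H →ₗ.[ℂ] H}
    (hApos : ∀ v : A.domain, 0 ≤ (⟪(A v : H), (v : H)⟫_ℂ).re) {ε : ℝ} (hε : 0 ≤ ε)
    (v : A.domain) : ‖A v‖ ^ 2 + (ε * ‖(v : H)‖) ^ 2 ≤ ‖A v + (ε : ℂ) • (v : H)‖ ^ 2 := by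
  rw [norm_add_sq (𝕜 := ℂ), inner_smul_right, norm_smul, Complex.norm_of_nonneg hε]
  have := mul_nonneg hε (hApos v)
  simp only [RCLike.re_to_complex, Complex.re_ofReal_mul]
  linarith

theorem norm_apply_le_norm_add_smul {A : H →ₗ.[ℂ] H}
    (hApos : ∀ v : A.domain, 0 ≤ (⟪(A v : H), (v : H)⟫_ℂ).re) {ε : ℝ} (hε : 0 ≤ ε)
    (v : A.domain) : ‖A v‖ ≤ ‖A v + (ε : ℂ) • (v : H)‖ :=
  le_of_pow_le_pow_left₀ two_ne_zero (norm_nonneg _)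
    ((le_add_of_nonneg_right (sq_nonneg _)).trans (norm_sq_add_le_norm_add_smul_sq hApos hε v))

theorem mul_norm_le_norm_add_smul {A : H →ₗ.[ℂ] H}
    (hApos : ∀ v : A.domain, 0 ≤ (⟪(A v : H), (v : H)⟫_ℂ).re) {ε : ℝ} (hε : 0 ≤ ε)
    (v : A.domain) : ε * ‖(v : H)‖ ≤ ‖A v + (ε : ℂ) • (v : H)‖ :=
  le_of_pow_le_pow_left₀ two_ne_zero (norm_nonneg _)
    ((le_add_of_nonneg_left (sq_nonneg _)).trans (norm_sq_add_le_norm_add_smul_sq hApos hε v))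

/-- The resolvent of a symmetric operator at a real point is symmetric. -/
theorem IsFormalAdjoint.inner_resolvent {A : H →ₗ.[ℂ] H} (hA : A.IsFormalAdjoint A) {ε : ℝ}
    {R : H →L[ℂ] H} (hR : ∀ u, ∃ hu : R u ∈ A.domain, A ⟨R u, hu⟩ + (ε : ℂ) • R u = u) (u w : H) :
    ⟪R u, w⟫_ℂ = ⟪u, R w⟫_ℂ := by
  obtain ⟨hu, eu⟩ := hR u
  obtain ⟨hw, ew⟩ := hR w
  have h := hA ⟨R u, hu⟩ ⟨R w, hw⟩
  rw [← eq_sub_iff_add_eq] at eu ew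
  simp only [eu, ew, inner_sub_left, inner_sub_right, inner_smul_left, inner_smul_right,
    Complex.conj_ofReal] at h
  linear_combination -h

theorem exists_norm_apply_apply_resolvent_sq_le {A : H →ₗ.[ℂ] H}
    (hApos : ∀ v : A.domain, 0 ≤ (⟪(A v : H), (v : H)⟫_ℂ).re) {ε : ℝ} (hε : 0 ≤ ε)
    {R : H →L[ℂ] H} (hR : ∀ u, ∃ hu : R u ∈ A.domain, A ⟨R u, hu⟩ + (ε : ℂ) • R u = u) (u : H) :
    ∃ (h1 : R (R u) ∈ A.domain) (h2 : A ⟨R (R u), h1⟩ ∈ A.domain),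
      ‖A ⟨A ⟨R (R u), h1⟩, h2⟩‖ ≤ ‖u‖ := by
  obtain ⟨h0, e0⟩ := hR u
  obtain ⟨h1, e1⟩ := hR (R u)
  have h2 : A ⟨R (R u), h1⟩ ∈ A.domain := by
    rw [eq_sub_of_add_eq e1]
    exact A.domain.sub_mem h0 (A.domain.smul_mem _ h1)
  refine ⟨h1, h2, ?_⟩
  have hz : (⟨A ⟨R (R u), h1⟩, h2⟩ : A.domain) + (ε : ℂ) • ⟨R (R u), h1⟩ = ⟨R u, h0⟩ :=
    Subtype.ext e1
  calc ‖A ⟨A ⟨R (R u), h1⟩, h2⟩‖ ≤ ‖A ⟨A ⟨R (R u), h1⟩, h2⟩ + (ε : ℂ) • A ⟨R (R u), h1⟩‖ :=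
        norm_apply_le_norm_add_smul hApos hε _
    _ = ‖A ⟨R u, h0⟩‖ := by rw [← hz, map_add, map_smul]
    _ ≤ ‖A ⟨R u, h0⟩ + (ε : ℂ) • R u‖ := norm_apply_le_norm_add_smul hApos hε ⟨R u, h0⟩
    _ = ‖u‖ := by rw [e0]

variable [CompleteSpace H]

theorem _root_.IsSelfAdjoint.isFormalAdjoint {A : H →ₗ.[ℂ] H} (hA : IsSelfAdjoint A) :
    A.IsFormalAdjoint A := by
  have h := adjoint_isFormalAdjoint hA.dense_domain
  rwa [isSelfAdjoint_def.1 hA] at h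

theorem _root_.IsSelfAdjoint.exists_apply_eq {A : H →ₗ.[ℂ] H} (hA : IsSelfAdjoint A) {y w : H}
    (h : ∀ x : A.domain, ⟪w, (x : H)⟫_ℂ = ⟪y, A x⟫_ℂ) : ∃ hy : y ∈ A.domain, A ⟨y, hy⟩ = w := by
  have hy := mem_adjoint_domain_of_exists y ⟨w, h⟩
  have heq := adjoint_apply_eq hA.dense_domain ⟨y, hy⟩ h
  have key : ∀ S : H →ₗ.[ℂ] H, S = A → ∀ hy : y ∈ S.domain, S ⟨y, hy⟩ = w →
      ∃ hy : y ∈ A.domain, A ⟨y, hy⟩ = w := by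
    rintro S rfl hy h
    exact ⟨hy, h⟩
  exact key _ (isSelfAdjoint_def.1 hA) hy heq

/-- A vector `y` with `|⟪y, B x⟫| ≤ c ‖x‖` on the domain of a selfadjoint `B` lies in this domain,
and `‖B y‖ ≤ c`. -/
theorem _root_.IsSelfAdjoint.exists_norm_apply_le {B : H →ₗ.[ℂ] H} (hB : IsSelfAdjoint B)
    {y : H} {c : ℝ} (hc : 0 ≤ c) (h : ∀ x : B.domain, ‖⟪y, B x⟫_ℂ‖ ≤ c * ‖(x : H)‖) :
    ∃ hy : y ∈ B.domain, ‖B ⟨y, hy⟩‖ ≤ c := by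
  have hcont : Continuous ((innerₛₗ ℂ y).comp B.toFun) :=
    AddMonoidHomClass.continuous_of_bound _ c h
  have hy : y ∈ B.domain := by
    rw [← isSelfAdjoint_def.1 hB]
    exact hcont
  refine ⟨hy, ?_⟩
  have hclosed : _root_.IsClosed {x : H | ‖⟪B ⟨y, hy⟩, x⟫_ℂ‖ ≤ c * ‖x‖} :=
    isClosed_le (by fun_prop) (by fun_prop)
  have hall : ‖⟪B ⟨y, hy⟩, B ⟨y, hy⟩⟫_ℂ‖ ≤ c * ‖B ⟨y, hy⟩‖ :=
    hclosed.closure_subset_iff.2 (fun x hx => by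
      have := h ⟨x, hx⟩
      rwa [← hB.isFormalAdjoint ⟨y, hy⟩ ⟨x, hx⟩] at this) (hB.dense_domain (B ⟨y, hy⟩))
  rw [inner_self_eq_norm_sq_to_K] at hall
  simp only [Complex.coe_algebraMap, norm_pow, Complex.norm_real, norm_norm] at hall
  rcases (norm_nonneg (B ⟨y, hy⟩)).eq_or_lt with h0 | h0
  · rwa [← h0]
  · nlinarith

theorem _root_.IsSelfAdjoint.range_add_smul_eq_top {A : H →ₗ.[ℂ] H} (hA : IsSelfAdjoint A)
    (hApos : ∀ v : A.domain, 0 ≤ (⟪(A v : H), (v : H)⟫_ℂ).re) {ε : ℝ} (hε : 0 < ε) :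
    LinearMap.range (A.toFun + (ε : ℂ) • A.domain.subtype) = ⊤ := by
  let f : A.graph →L[ℂ] H :=
    (ContinuousLinearMap.snd ℂ H H + (ε : ℂ) • ContinuousLinearMap.fst ℂ H H).comp A.graph.subtypeL
  have hcomplete : CompleteSpace A.graph := hA.isClosed.completeSpace_coe
  have hf : AntilipschitzWith (max 1 (Real.toNNReal ε⁻¹)) f := by
    refine AddMonoidHomClass.antilipschitz_of_bound f ?_
    rintro ⟨⟨x, y⟩, hxy⟩
    obtain ⟨v, rfl, rfl⟩ := (mem_graph_iff A).1 hxy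
    have h1 := norm_apply_le_norm_add_smul hApos hε.le v
    have h2 := mul_norm_le_norm_add_smul hApos hε.le v
    have h3 : ‖(v : H)‖ ≤ ε⁻¹ * ‖A v + (ε : ℂ) • (v : H)‖ := by
      rwa [le_inv_mul_iff₀ hε]
    change max ‖(v : H)‖ ‖A v‖ ≤ _ * ‖A v + (ε : ℂ) • (v : H)‖
    rw [NNReal.coe_max, Real.coe_toNNReal _ (inv_nonneg.2 hε.le), NNReal.coe_one]
    refine max_le (h3.trans ?_) (h1.trans ?_)
    · gcongr
      exact le_max_right _ _
    · exact le_mul_of_one_le_left (norm_nonneg _) (le_max_left _ _)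
  have hrange : (LinearMap.range (A.toFun + (ε : ℂ) • A.domain.subtype) : Set H) = Set.range f := by
    ext z
    constructor
    · rintro ⟨v, rfl⟩
      exact ⟨⟨_, A.mem_graph v⟩, rfl⟩
    · rintro ⟨⟨⟨x, y⟩, hxy⟩, rfl⟩
      obtain ⟨v, rfl, rfl⟩ := (mem_graph_iff A).1 hxy
      exact ⟨v, rfl⟩
  have hclosed : _root_.IsClosed (LinearMap.range (A.toFun + (ε : ℂ) • A.domain.subtype) : Set H) := by
    rw [hrange]
    exact hf.isClosed_range f.uniformContinuous
  have := hclosed.completeSpace_coe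
  rw [← Submodule.orthogonal_eq_bot_iff, Submodule.eq_bot_iff]
  intro y hy
  rw [Submodule.mem_orthogonal'] at hy
  obtain ⟨hyA, hAy⟩ := hA.exists_apply_eq (y := y) (w := -((ε : ℂ) • y)) fun x => by
    have := hy _ ⟨x, rfl⟩
    change ⟪y, A x + (ε : ℂ) • (x : H)⟫_ℂ = 0 at this
    rw [inner_add_right, inner_smul_right] at this
    rw [inner_neg_left, inner_smul_left, Complex.conj_ofReal]
    linear_combination -this
  have h := mul_norm_le_norm_add_smul hApos hε.le ⟨y, hyA⟩
  rw [hAy, neg_add_cancel, norm_zero] at h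
  exact norm_eq_zero.1 (le_antisymm (nonpos_of_mul_nonpos_right h hε) (norm_nonneg _))

/-- The resolvent of a positive selfadjoint operator at a point of the negative real axis. -/
theorem _root_.IsSelfAdjoint.exists_resolvent {A : H →ₗ.[ℂ] H} (hA : IsSelfAdjoint A)
    (hApos : ∀ v : A.domain, 0 ≤ (⟪(A v : H), (v : H)⟫_ℂ).re) {ε : ℝ} (hε : 0 < ε) :
    ∃ R : H →L[ℂ] H, (∀ u, ∃ hu : R u ∈ A.domain, A ⟨R u, hu⟩ + (ε : ℂ) • R u = u) ∧
      ∀ v : A.domain, R (A v + (ε : ℂ) • (v : H)) = v := by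
  have hinj : Function.Injective (A.toFun + (ε : ℂ) • A.domain.subtype) := by
    rw [injective_iff_map_eq_zero]
    intro v hv
    have h := mul_norm_le_norm_add_smul hApos hε.le v
    change A v + (ε : ℂ) • (v : H) = 0 at hv
    rw [hv, norm_zero] at h
    exact Subtype.ext
      (norm_eq_zero.1 (le_antisymm (nonpos_of_mul_nonpos_right h hε) (norm_nonneg _)))
  let e := LinearEquiv.ofBijective _
    ⟨hinj, LinearMap.range_eq_top.1 (hA.range_add_smul_eq_top hApos hε)⟩
  have he : ∀ v, e v = A v + (ε : ℂ) • (v : H) := fun v => rfl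
  refine ⟨(A.domain.subtype ∘ₗ e.symm.toLinearMap).mkContinuous ε⁻¹ fun u => ?_,
    fun u => ⟨(e.symm u).2, ?_⟩, fun v => ?_⟩
  · have h := mul_norm_le_norm_add_smul hApos hε.le (e.symm u)
    rw [← he, e.apply_symm_apply] at h
    rwa [le_inv_mul_iff₀ hε]
  · change A (e.symm u) + (ε : ℂ) • (e.symm u : H) = u
    rw [← he, e.apply_symm_apply]
  · rw [← he]
    change ((e.symm (e v) : A.domain) : H) = v
    rw [e.symm_apply_apply]

/-- The interpolation inequality on the range of the square of the resolvent. -/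
theorem exists_norm_apply_resolvent_sq_le {A B : H →ₗ.[ℂ] H} (hA : A.IsFormalAdjoint A)
    (hB : B.IsFormalAdjoint B)
    (hApos : ∀ v : A.domain, 0 ≤ (⟪(A v : H), (v : H)⟫_ℂ).re)
    (T : H →L[ℂ] H) {C : ℝ} (hC : 0 ≤ C)
    (hmap : ∀ (v : A.domain), (A v : H) ∈ A.domain →
      ∃ hTv : T (v : H) ∈ B.domain, (B ⟨T (v : H), hTv⟩ : H) ∈ B.domain)
    (hbound : ∀ (v : A.domain) (hv2 : (A v : H) ∈ A.domain)
      (hTv : T (v : H) ∈ B.domain) (hTv2 : (B ⟨T (v : H), hTv⟩ : H) ∈ B.domain),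
      ‖(B ⟨(B ⟨T (v : H), hTv⟩ : H), hTv2⟩ : H)‖ ≤ C * ‖(A ⟨(A v : H), hv2⟩ : H)‖)
    {ε : ℝ} (hε : 0 ≤ ε) {R : H →L[ℂ] H}
    (hR : ∀ u, ∃ hu : R u ∈ A.domain, A ⟨R u, hu⟩ + (ε : ℂ) • R u = u) (u : H) :
    ∃ h : T (R (R u)) ∈ B.domain, ‖B ⟨T (R (R u)), h⟩‖ ≤ √(‖T‖ * C) * ‖R u‖ := by
  choose d1 d2 hd using exists_norm_apply_apply_resolvent_sq_le hApos hε hR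
  choose b1 b2 using fun u => hmap ⟨R (R u), d1 u⟩ (d2 u)
  have hRsymm := hA.inner_resolvent hR
  let P : H → H := fun u => ContinuousLinearMap.adjoint T (B ⟨B ⟨T (R (R u)), b1 u⟩, b2 u⟩)
  have hinner : ∀ u w, ⟪P u, R (R w)⟫_ℂ = ⟪B ⟨T (R (R u)), b1 u⟩, B ⟨T (R (R w)), b1 w⟩⟫_ℂ := by
    intro u w
    rw [ContinuousLinearMap.adjoint_inner_left]
    exact hB ⟨_, b2 u⟩ ⟨_, b1 w⟩
  have hP : ∀ u, ‖P u‖ ≤ ‖T‖ * C * ‖u‖ := by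
    intro u
    calc ‖P u‖ ≤ ‖ContinuousLinearMap.adjoint T‖ * ‖B ⟨B ⟨T (R (R u)), b1 u⟩, b2 u⟩‖ :=
          ContinuousLinearMap.le_opNorm _ _
      _ ≤ ‖T‖ * (C * ‖u‖) := by
          rw [LinearIsometryEquiv.norm_map]
          gcongr
          exact (hbound ⟨R (R u), d1 u⟩ (d2 u) (b1 u) (b2 u)).trans (by gcongr; exact hd u)
      _ = ‖T‖ * C * ‖u‖ := by ring
  have hPsymm : ∀ u w, ⟪R (P u), R w⟫_ℂ = ⟪R u, R (P w)⟫_ℂ := by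
    intro u w
    rw [hRsymm, hinner, ← hRsymm (R u), ← inner_conj_symm (R (R u)), hinner, inner_conj_symm]
  have hreid := norm_apply_le_of_symmetrizable R P (mul_nonneg (norm_nonneg T) hC) hP hPsymm u
  refine ⟨b1 u, le_of_pow_le_pow_left₀ two_ne_zero (by positivity) ?_⟩
  calc ‖B ⟨T (R (R u)), b1 u⟩‖ ^ 2 = ‖⟪R (P u), R u⟫_ℂ‖ := by
        rw [hRsymm, hinner, inner_self_eq_norm_sq_to_K]
        simp
    _ ≤ ‖R (P u)‖ * ‖R u‖ := norm_inner_le_norm _ _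
    _ ≤ ‖T‖ * C * ‖R u‖ * ‖R u‖ := by gcongr
    _ = (√(‖T‖ * C) * ‖R u‖) ^ 2 := by
        rw [mul_pow, Real.sq_sqrt (by positivity)]
        ring

end LinearPMap

end

theorem interpolation_sqrt_bound
    {H : Type*} [NormedAddCommGroup H] [InnerProductSpace ℂ H] [CompleteSpace H]
    -- A and B are positive selfadjoint (in general unbounded) operators on H
    (A B : H →ₗ.[ℂ] H)
    (hA : IsSelfAdjoint A) (hB : IsSelfAdjoint B)
    (hApos : ∀ v : A.domain, 0 ≤ (⟪(A v : H), (v : H)⟫_ℂ).re)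
    (hBpos : ∀ v : B.domain, 0 ≤ (⟪(B v : H), (v : H)⟫_ℂ).re)
    (T : H →L[ℂ] H) (C : ℝ) (hC : 0 < C)
    -- T maps D(A²) into D(B²) ...
    (hmap : ∀ (v : A.domain), (A v : H) ∈ A.domain →
      ∃ hTv : T (v : H) ∈ B.domain, (B ⟨T (v : H), hTv⟩ : H) ∈ B.domain)
    -- ... with ‖B²Tv‖ ≤ C‖A²v‖ for v ∈ D(A²)
    (hbound : ∀ (v : A.domain) (hv2 : (A v : H) ∈ A.domain)
      (hTv : T (v : H) ∈ B.domain) (hTv2 : (B ⟨T (v : H), hTv⟩ : H) ∈ B.domain),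
      ‖(B ⟨(B ⟨T (v : H), hTv⟩ : H), hTv2⟩ : H)‖ ≤ C * ‖(A ⟨(A v : H), hv2⟩ : H)‖) :
    -- then T maps D(A) into D(B) with ‖BTv‖ ≤ √(‖T‖C)·‖Av‖
    ∀ v : A.domain, ∃ hTv : T (v : H) ∈ B.domain,
      ‖(B ⟨T (v : H), hTv⟩ : H)‖ ≤ Real.sqrt (‖T‖ * C) * ‖(A v : H)‖ := by
  intro v
  refine hB.exists_norm_apply_le (by positivity) fun x => ?_
  have hreg : ∀ ε : ℝ, 0 < ε →
      ‖⟪T v, B x⟫_ℂ‖ ≤ √(‖T‖ * C) * ‖A v + (ε : ℂ) • (v : H)‖ * ‖(x : H)‖ := by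
    intro ε hε
    obtain ⟨R, hR, hR'⟩ := hA.exists_resolvent hApos hε
    have hclosed : IsClosed {u : H | ‖⟪T (R u), B x⟫_ℂ‖ ≤ √(‖T‖ * C) * ‖u‖ * ‖(x : H)‖} :=
      isClosed_le (by fun_prop) (by fun_prop)
    have hall := hclosed.closure_subset_iff.2 (fun u hu => ?_)
      (hA.dense_domain (A v + (ε : ℂ) • (v : H)))
    · rwa [Set.mem_ofPred_eq, hR' v] at hall
    · obtain ⟨h, hle⟩ := LinearPMap.exists_norm_apply_resolvent_sq_le hA.isFormalAdjoint
        hB.isFormalAdjoint hApos T hC.le hmap hbound hε.le hR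
        (A ⟨u, hu⟩ + (ε : ℂ) • u)
      have hu' := hR' ⟨u, hu⟩
      simp only [hu'] at h hle
      rw [Set.mem_ofPred_eq, ← hB.isFormalAdjoint ⟨_, h⟩ x]
      exact (norm_inner_le_norm _ _).trans (by gcongr)
  have hlim : Filter.Tendsto
      (fun ε : ℝ => √(‖T‖ * C) * ‖A v + (ε : ℂ) • (v : H)‖ * ‖(x : H)‖)
      (nhdsWithin 0 (Set.Ioi 0)) (nhds (√(‖T‖ * C) * ‖A v‖ * ‖(x : H)‖)) := by
    have hcont : Continuous
        (fun ε : ℝ => √(‖T‖ * C) * ‖A v + (ε : ℂ) • (v : H)‖ * ‖(x : H)‖) := by fun_prop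
    simpa using (hcont.tendsto 0).mono_left nhdsWithin_le_nhds
  exact ge_of_tendsto hlim (Filter.eventually_of_mem self_mem_nhdsWithin hreg)
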